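/- Let D be a block design with parameters (v, b, r, 3, 1) built on a finite set V (block size k = 3 and λ = 1), with v ≥ 4. Let D₁^{(4)} be the block design formed by all 4-element subsets of V containing at least one block of D, and D₂^{(4)} the collection of all 4-element subsets of V containing no block of D (assumed nonempty). Then both D₁^{(4)} and D₂^{(4)} are friends with D. Moreover: z_3(D₁^{(4)}, B) = v − 3 for every block B of D; z_3(D, T) = 1 for every block T of D₁^{(4)}; z_3(D₂^{(4)}, B) = 0 for every block B of D; and z_3(D, T') = 0 for every block T' of D₂^{(4)}. -/

import Mathlib

open Finset

variable {V : Type*}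

/-- `zval D M j` is the number of blocks `B` of `D` with `|M ∩ B| = j`. -/
def zval [DecidableEq V] (D : Finset (Finset V)) (M : Finset V) (j : ℕ) : ℕ :=
  (D.filter fun B => (M ∩ B).card = j).card

/-- A (simple) balanced incomplete block design with parameters `(v, b, r, k, lam)`
built on the finite set `V`. -/
structure IsBIBD [Fintype V] [DecidableEq V] (D : Finset (Finset V))
    (v b r k lam : ℕ) : Prop where
  card_pts : Fintype.card V = v
  card_blocks : D.card = b
  block_size : ∀ B ∈ D, B.card = k
  repl : ∀ x : V, (D.filter fun B => x ∈ B).card = r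
  balance : ∀ x y : V, x ≠ y → (D.filter fun B => x ∈ B ∧ y ∈ B).card = lam

/-- Two block designs on the same set `V` are friends if, for every `j`,
`zval D₁ B₂ j` does not depend on the choice of block `B₂` of `D₂`, and
`zval D₂ B₁ j` does not depend on the choice of block `B₁` of `D₁`. -/
def IsFriends [DecidableEq V] (D₁ D₂ : Finset (Finset V)) : Prop :=
  (∀ j : ℕ, ∀ B ∈ D₂, ∀ B' ∈ D₂, zval D₁ B j = zval D₁ B' j) ∧
  (∀ j : ℕ, ∀ B ∈ D₁, ∀ B' ∈ D₁, zval D₂ B j = zval D₂ B' j)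

theorem zval_eq_zero_of_lt [DecidableEq V] {D : Finset (Finset V)} {k : ℕ}
    (hsize : ∀ B ∈ D, B.card = k) (M : Finset V) {j : ℕ} (hj : k < j) : zval D M j = 0 := by
  rw [zval, card_eq_zero, filter_eq_empty_iff]
  intro B hB h
  have := card_le_card (inter_subset_right : M ∩ B ⊆ B)
  rw [hsize B hB] at this
  omega

/-- In a design with block size `3`, a sum over the blocks of a function of `|M ∩ B|` is
a combination of the numbers `zval D M j`. -/
theorem sum_card_inter_eq_sum_zval [DecidableEq V] {D : Finset (Finset V)}
    (hsize : ∀ B ∈ D, B.card = 3) (M : Finset V) (g : ℕ → ℕ) :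
    ∑ B ∈ D, g (M ∩ B).card = ∑ j ∈ range 4, zval D M j * g j := by
  have hmaps : ∀ B ∈ D, (M ∩ B).card ∈ range 4 := fun B hB => by
    have := card_le_card (inter_subset_right : M ∩ B ⊆ B)
    rw [hsize B hB] at this
    exact mem_range.2 (by omega)
  rw [← sum_fiberwise_of_maps_to hmaps]
  refine sum_congr rfl fun j _ => ?_
  rw [sum_congr rfl (g := fun _ => g j) fun B hB => by rw [(mem_filter.1 hB).2]]
  simp [zval]

theorem card_inter_eq_card_right_iff {α : Type*} [DecidableEq α] {M B : Finset α} :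
    (M ∩ B).card = B.card ↔ B ⊆ M :=
  ⟨fun h => inter_eq_right.1 (eq_of_subset_of_card_le inter_subset_right h.ge),
    fun h => by rw [inter_eq_right.2 h]⟩

theorem zval_eq_zero_of_not_subset [DecidableEq V] {D : Finset (Finset V)} {k : ℕ}
    (hsize : ∀ B ∈ D, B.card = k) {T : Finset V} (hT : ∀ B ∈ D, ¬ B ⊆ T) : zval D T k = 0 := by
  rw [zval, card_eq_zero, filter_eq_empty_iff]
  intro B hB h
  rw [← hsize B hB, card_inter_eq_card_right_iff] at h
  exact hT B hB h

section BIBD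

variable [Fintype V] [DecidableEq V] {D : Finset (Finset V)} {v b r k lam : ℕ}

/-- The second factorial moment of the block intersection sizes. -/
theorem IsBIBD.sum_card_inter_mul_pred (hD : IsBIBD D v b r k lam) (M : Finset V) :
    ∑ B ∈ D, ((M ∩ B).card * (M ∩ B).card - (M ∩ B).card) =
      (M.card * M.card - M.card) * lam := by
  have h := sum_card_bipartiteAbove_eq_sum_card_bipartiteBelow
    (s := D) (t := M.offDiag) (fun B p => p.1 ∈ B ∧ p.2 ∈ B)
  simp only [bipartiteBelow] at h
  rw [sum_congr (s₁ := M.offDiag) rfl fun p hp =>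
    hD.balance p.1 p.2 (mem_offDiag.1 hp).2.2] at h
  rw [sum_const, smul_eq_mul, offDiag_card] at h
  rw [← h]
  refine sum_congr rfl fun B _ => ?_
  rw [← offDiag_card]
  congr 1
  ext p
  simp only [mem_offDiag, mem_inter, bipartiteAbove, mem_filter]
  tauto

/-- The three moment equations for the intersection numbers of a set with a design of
block size `3`. -/
theorem IsBIBD.zval_moments (hD : IsBIBD D v b r 3 lam) (M : Finset V) :
    zval D M 0 + zval D M 1 + zval D M 2 + zval D M 3 = b ∧
    zval D M 1 + zval D M 2 * 2 + zval D M 3 * 3 = M.card * r ∧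
    zval D M 2 * 2 + zval D M 3 * 6 = (M.card * M.card - M.card) * lam := by
  have h0 := sum_card_inter_eq_sum_zval hD.block_size M fun _ => 1
  have h1 := sum_card_inter_eq_sum_zval hD.block_size M fun i => i
  have h2 := sum_card_inter_eq_sum_zval hD.block_size M fun i => i * i - i
  rw [sum_const, hD.card_blocks] at h0
  rw [sum_card_inter fun a _ => hD.repl a] at h1
  rw [hD.sum_card_inter_mul_pred] at h2
  simp only [sum_range_succ, sum_range_zero, smul_eq_mul] at h0 h1 h2
  refine ⟨by omega, by omega, by omega⟩

theorem IsBIBD.zval_congr (hD : IsBIBD D v b r 3 lam) {M M' : Finset V}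
    (hcard : M.card = M'.card) (h3 : zval D M 3 = zval D M' 3) (j : ℕ) :
    zval D M j = zval D M' j := by
  obtain ⟨a0, a1, a2⟩ := hD.zval_moments M
  obtain ⟨b0, b1, b2⟩ := hD.zval_moments M'
  rw [← hcard] at b1 b2
  rcases lt_or_ge 3 j with hj | hj
  · rw [zval_eq_zero_of_lt hD.block_size M hj, zval_eq_zero_of_lt hD.block_size M' hj]
  · interval_cases j <;> omega

/-- Two blocks sharing two points coincide when `λ = 1`. -/
theorem IsBIBD.eq_of_two_le_card_inter (hD : IsBIBD D v b r k 1) {B C : Finset V}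
    (hB : B ∈ D) (hC : C ∈ D) (h : 2 ≤ (B ∩ C).card) : B = C := by
  obtain ⟨x, hx, y, hy, hxy⟩ := one_lt_card.1 h
  rw [mem_inter] at hx hy
  exact card_le_one.1 (hD.balance x y hxy).le B (mem_filter.2 ⟨hB, hx.1, hy.1⟩) C
    (mem_filter.2 ⟨hC, hx.2, hy.2⟩)

theorem IsBIBD.eq_of_subset_of_subset (hD : IsBIBD D v b r 3 1) {B C T : Finset V}
    (hB : B ∈ D) (hC : C ∈ D) (hT : T.card ≤ 4) (hBT : B ⊆ T) (hCT : C ⊆ T) : B = C := by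
  refine hD.eq_of_two_le_card_inter hB hC ?_
  have h1 := card_union_add_card_inter B C
  have h2 := card_le_card (union_subset hBT hCT)
  rw [hD.block_size B hB, hD.block_size C hC] at h1
  omega

theorem IsBIBD.zval_block_size_eq_one (hD : IsBIBD D v b r 3 1) {B T : Finset V}
    (hB : B ∈ D) (hT : T.card ≤ 4) (hBT : B ⊆ T) : zval D T 3 = 1 := by
  rw [zval, card_eq_one]
  refine ⟨B, eq_singleton_iff_unique_mem.2 ⟨mem_filter.2 ⟨hB, ?_⟩, fun C hC => ?_⟩⟩
  · rw [inter_eq_right.2 hBT, hD.block_size B hB]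
  · obtain ⟨hC, h⟩ := mem_filter.1 hC
    rw [← hD.block_size C hC, card_inter_eq_card_right_iff] at h
    exact hD.eq_of_subset_of_subset hC hB hT h hBT

/-- The number of one-point extensions of `C` meeting `B` in `j` points. -/
theorem card_filter_extensions (B C : Finset V) (j : ℕ) :
    ((powersetCard (C.card + 1) (univ : Finset V)).filter
      fun T => C ⊆ T ∧ (B ∩ T).card = j).card =
      (if (B ∩ C).card + 1 = j then B.card - (B ∩ C).card else 0) +
      (if (B ∩ C).card = j then
        Fintype.card V - (B.card + C.card - (B ∩ C).card) else 0) := by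
  have himg : ((powersetCard (C.card + 1) (univ : Finset V)).filter
      fun T => C ⊆ T ∧ (B ∩ T).card = j) =
      (Cᶜ.filter fun p => (B ∩ insert p C).card = j).image fun p => insert p C := by
    ext T
    simp only [mem_filter, mem_powersetCard, mem_image, subset_univ, true_and, mem_compl]
    constructor
    · rintro ⟨hT, hCT, hj⟩
      have : (T \ C).card = 1 := by rw [card_sdiff_of_subset hCT]; omega
      obtain ⟨p, hp⟩ := card_eq_one.1 this
      have hpT : insert p C = T := by
        rw [insert_eq, ← hp, sdiff_union_of_subset hCT]
      have hpC : p ∈ T \ C := hp ▸ mem_singleton_self p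
      exact ⟨p, ⟨(mem_sdiff.1 hpC).2, by rwa [hpT]⟩, hpT⟩
    · rintro ⟨p, ⟨hp, hj⟩, rfl⟩
      exact ⟨card_insert_of_notMem hp, subset_insert _ _, hj⟩
  have hinj : Set.InjOn (fun p => insert p C)
      (Cᶜ.filter fun p => (B ∩ insert p C).card = j : Finset V) := by
    intro p hp q _ hpq
    have hpC : p ∉ C := mem_compl.1 (mem_filter.1 hp).1
    have : p ∈ insert q C := by
      rw [← show insert p C = insert q C from hpq]; exact mem_insert_self p C
    exact (mem_insert.1 this).resolve_right hpC
  rw [himg, card_image_of_injOn hinj, ← card_filter_add_card_filter_not (fun p => p ∈ B),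
    filter_filter, filter_filter]
  congr 1
  · have : (Cᶜ.filter fun p => (B ∩ insert p C).card = j ∧ p ∈ B) =
        (B \ C).filter fun _ => (B ∩ C).card + 1 = j := by
      ext p
      simp only [mem_filter, mem_compl, mem_sdiff]
      constructor
      · rintro ⟨hpC, hj, hpB⟩
        rw [inter_insert_of_mem hpB, card_insert_of_notMem (by simp [hpC])] at hj
        exact ⟨⟨hpB, hpC⟩, hj⟩
      · rintro ⟨⟨hpB, hpC⟩, hj⟩
        rw [inter_insert_of_mem hpB, card_insert_of_notMem (by simp [hpC])]
        exact ⟨hpC, hj, hpB⟩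
    rw [this, filter_const]
    split_ifs
    · rw [card_sdiff, inter_comm]
    · rfl
  · have : (Cᶜ.filter fun p => (B ∩ insert p C).card = j ∧ p ∉ B) =
        ((B ∪ C)ᶜ).filter fun _ => (B ∩ C).card = j := by
      ext p
      simp only [mem_filter, mem_compl, mem_union, not_or]
      constructor
      · rintro ⟨hpC, hj, hpB⟩
        rw [inter_insert_of_notMem hpB] at hj
        exact ⟨⟨hpB, hpC⟩, hj⟩
      · rintro ⟨⟨hpB, hpC⟩, hj⟩
        rw [inter_insert_of_notMem hpB]
        exact ⟨hpC, hj, hpB⟩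
    rw [this, filter_const]
    split_ifs
    · rw [card_compl, card_union]
    · rfl

/-- The intersection numbers of a triple `B` with the `4`-sets containing a block of `D`,
in terms of the intersection numbers of `B` with `D`. -/
theorem IsBIBD.zval_extensions (hD : IsBIBD D v b r 3 1) {B : Finset V} (hB : B.card = 3)
    (j : ℕ) :
    zval ((powersetCard 4 (univ : Finset V)).filter fun T => ∃ C ∈ D, C ⊆ T) B j =
      ∑ i ∈ range 4, zval D B i *
        ((if i + 1 = j then 3 - i else 0) + (if i = j then v - (6 - i) else 0)) := by
  rw [← sum_card_inter_eq_sum_zval hD.block_size B fun i =>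
    (if i + 1 = j then 3 - i else 0) + (if i = j then v - (6 - i) else 0)]
  have hunion : (((powersetCard 4 (univ : Finset V)).filter fun T => ∃ C ∈ D, C ⊆ T).filter
      fun T => (B ∩ T).card = j) = D.biUnion fun C =>
        (powersetCard 4 (univ : Finset V)).filter fun T => C ⊆ T ∧ (B ∩ T).card = j := by
    ext T
    simp only [mem_filter, mem_biUnion]
    tauto
  rw [zval, hunion, card_biUnion]
  · refine sum_congr rfl fun C hC => ?_
    have h := card_filter_extensions B C j
    rw [hD.block_size C hC, hB, hD.card_pts] at h
    exact h
  · intro C hC C' hC' hne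
    refine disjoint_left.2 fun T hT hU => hne ?_
    simp only [mem_filter, mem_powersetCard] at hT hU
    exact hD.eq_of_subset_of_subset hC hC' hT.1.2.le hT.2.1 hU.2.1

/-- The intersection numbers of `M` with the family of all `n`-sets only depend on `|M|`. -/
theorem zval_powersetCard_congr {M M' : Finset V} (h : M.card = M'.card) (n j : ℕ) :
    zval (powersetCard n (univ : Finset V)) M j = zval (powersetCard n univ) M' j := by
  let e : {x // x ∈ M} ≃ {x // x ∈ M'} := Finset.equivOfCardEq h
  let σ : Equiv.Perm V := e.extendSubtype
  have hσ : M.map σ.toEmbedding = M' := by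
    refine eq_of_subset_of_card_le (fun y hy => ?_) (by rw [card_map, h])
    obtain ⟨x, hx, rfl⟩ := mem_map.1 hy
    exact e.extendSubtype_mem x hx
  refine card_equiv (Equiv.finsetCongr σ) fun T => ?_
  simp only [mem_filter, mem_powersetCard, subset_univ, true_and, Equiv.finsetCongr_apply,
    card_map, ← hσ, ← map_inter]

end BIBD

theorem zval_filter_add_zval_filter_not [DecidableEq V] (D : Finset (Finset V))
    (p : Finset V → Prop) [DecidablePred p] (M : Finset V) (j : ℕ) :
    zval (D.filter p) M j + zval (D.filter fun T => ¬ p T) M j = zval D M j := by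
  simp only [zval]
  rw [filter_comm, filter_comm (fun T => ¬ p T)]
  exact card_filter_add_card_filter_not p

theorem stmt_19 [Fintype V] [DecidableEq V] (D : Finset (Finset V))
    (v b r : ℕ) (hD : IsBIBD D v b r 3 1) (hv : 4 ≤ v)
    (D₁ D₂ : Finset (Finset V))
    (hD₁ : D₁ = (Finset.powersetCard 4 (Finset.univ : Finset V)).filter
        fun T => ∃ B ∈ D, B ⊆ T)
    (hD₂ : D₂ = (Finset.powersetCard 4 (Finset.univ : Finset V)).filter
        fun T => ∀ B ∈ D, ¬ B ⊆ T)
    (hne : D₂.Nonempty) :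
    IsFriends D D₁ ∧ IsFriends D D₂ ∧
    (∀ B ∈ D, zval D₁ B 3 = v - 3) ∧
    (∀ T ∈ D₁, zval D T 3 = 1) ∧
    (∀ B ∈ D, zval D₂ B 3 = 0) ∧
    (∀ T' ∈ D₂, zval D T' 3 = 0) := by
  have hD₂' : D₂ = (powersetCard 4 (univ : Finset V)).filter
      fun T => ¬ ∃ B ∈ D, B ⊆ T := by
    rw [hD₂]
    exact filter_congr fun T _ => by push Not; rfl
  have hD₁card : ∀ T ∈ D₁, T.card = 4 := fun T hT => by
    rw [hD₁] at hT
    exact (mem_powersetCard.1 (mem_filter.1 hT).1).2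
  have hD₂card : ∀ T ∈ D₂, T.card = 4 := fun T hT => by
    rw [hD₂] at hT
    exact (mem_powersetCard.1 (mem_filter.1 hT).1).2
  have hB3 : ∀ B ∈ D, zval D B 3 = 1 := fun B hB =>
    hD.zval_block_size_eq_one hB (by rw [hD.block_size B hB]; norm_num) Subset.rfl
  have hT3 : ∀ T ∈ D₁, zval D T 3 = 1 := fun T hT => by
    have hT' := hT
    rw [hD₁] at hT'
    obtain ⟨B, hB, hBT⟩ := (mem_filter.1 hT').2
    exact hD.zval_block_size_eq_one hB (hD₁card T hT).le hBT
  have hT3' : ∀ T ∈ D₂, zval D T 3 = 0 := fun T hT => by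
    rw [hD₂] at hT
    exact zval_eq_zero_of_not_subset hD.block_size (mem_filter.1 hT).2
  have hBcard : ∀ B ∈ D, ∀ B' ∈ D, B.card = B'.card := fun B hB B' hB' => by
    rw [hD.block_size B hB, hD.block_size B' hB']
  have hBD₁ : ∀ j, ∀ B ∈ D, ∀ B' ∈ D, zval D₁ B j = zval D₁ B' j := fun j B hB B' hB' => by
    rw [hD₁, hD.zval_extensions (hD.block_size B hB), hD.zval_extensions (hD.block_size B' hB')]
    refine sum_congr rfl fun i _ => ?_
    rw [hD.zval_congr (hBcard B hB B' hB') (by rw [hB3 B hB, hB3 B' hB']) i]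
  refine ⟨⟨fun j T hT T' hT' => ?_, hBD₁⟩, ⟨fun j T hT T' hT' => ?_, fun j B hB B' hB' => ?_⟩,
    fun B hB => ?_, hT3, fun B hB => ?_, hT3'⟩
  · exact hD.zval_congr (by rw [hD₁card T hT, hD₁card T' hT']) (by rw [hT3 T hT, hT3 T' hT']) j
  · exact hD.zval_congr (by rw [hD₂card T hT, hD₂card T' hT']) (by rw [hT3' T hT, hT3' T' hT']) j
  · have h := zval_filter_add_zval_filter_not (powersetCard 4 (univ : Finset V))
      (fun T => ∃ B ∈ D, B ⊆ T) B j
    have h' := zval_filter_add_zval_filter_not (powersetCard 4 (univ : Finset V))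
      (fun T => ∃ B ∈ D, B ⊆ T) B' j
    rw [← hD₁, ← hD₂'] at h h'
    have hall := zval_powersetCard_congr (hBcard B hB B' hB') 4 j
    have hone := hBD₁ j B hB B' hB'
    omega
  · obtain ⟨-, -, h2⟩ := hD.zval_moments B
    rw [hB3 B hB, hD.block_size B hB] at h2
    have h2' : zval D B 2 = 0 := by omega
    rw [hD₁, hD.zval_extensions (hD.block_size B hB)]
    simp [sum_range_succ, hB3 B hB, h2']
  · rw [zval, card_eq_zero, filter_eq_empty_iff]
    intro T hT h
    rw [inter_comm, ← hD.block_size B hB, card_inter_eq_card_right_iff] at h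
    rw [hD₂] at hT
    exact (mem_filter.1 hT).2 B hB h
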